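/- Let φ(x) = x³ + 7x² − 7 ∈ ℤ[x]. Then Gal(K_1/ℚ) has order 3 (cyclic of order 3), and for every n ≥ 2 the extension K_n/K_{n−1} is maximal, i.e. Gal(K_n/K_{n−1}) has order 6^{3^{n−1}}. (Consequently the image of the arboreal Galois representation of φ over ℚ is an index-2 subgroup of Aut(T_∞): it is of finite index yet not surjective.) -/

import Mathlib

open Polynomial

noncomputable section

/-- The `n`-th iterate of a polynomial under composition: `polyIter φ 0 = X`,
`polyIter φ (n+1) = φ ∘ (polyIter φ n)`. -/
def polyIter {R : Type*} [CommRing R] (φ : Polynomial R) : ℕ → Polynomial R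
  | 0 => X
  | n + 1 => φ.comp (polyIter φ n)

/-- The splitting field `K_n` of the `n`-th iterate of `φ ∈ ℤ[x]` over `ℚ`, inside a fixed
algebraic closure of `ℚ`. -/
def Kfield (φ : Polynomial ℤ) (n : ℕ) : IntermediateField ℚ (AlgebraicClosure ℚ) :=
  IntermediateField.adjoin ℚ ((polyIter φ n).rootSet (AlgebraicClosure ℚ))

/-- The order of `Gal(K_n / K_{n-1})`: the number of automorphisms of `K_n` over `ℚ`
fixing every element of `K_{n-1}` pointwise. -/
def relGalCard (φ : Polynomial ℤ) (n : ℕ) : ℕ :=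
  Nat.card {σ : Kfield φ n ≃ₐ[ℚ] Kfield φ n //
    ∀ (x : AlgebraicClosure ℚ) (_ : x ∈ Kfield φ (n - 1)) (hx' : x ∈ Kfield φ n),
      σ ⟨x, hx'⟩ = ⟨x, hx'⟩}

end

/-- The polynomial `X³ + 7X² - 7`. -/
noncomputable def cubicPoly : ℤ[X] := X ^ 3 + C 7 * X ^ 2 - C 7

/-- The polynomial function `x ↦ x³ + 7x² - 7` on a commutative ring. -/
def cubic {R : Type*} [CommRing R] (x : R) : R := x ^ 3 + 7 * x ^ 2 - 7

section Iterates

variable {R : Type*} [CommRing R]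

theorem aeval_polyIter [Algebra ℤ R] (n : ℕ) (x : R) :
    aeval x (polyIter cubicPoly n) = cubic^[n] x := by
  induction n with
  | zero => simp [polyIter]
  | succ n ih =>
    rw [polyIter, aeval_comp, ih, Function.iterate_succ_apply', cubicPoly, cubic]
    simp only [map_sub, map_add, map_mul, map_pow, aeval_X, aeval_C]
    simp

theorem eval_map_polyIter (n : ℕ) (x : R) :
    ((polyIter cubicPoly n).map (Int.castRingHom R)).eval x = cubic^[n] x := by
  rw [← aeval_polyIter, eval_map, aeval_def, algebraMap_int_eq]

theorem map_cubic {S : Type*} [CommRing S] (f : R →+* S) (x : R) : f (cubic x) = cubic (f x) := by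
  simp [cubic, map_ofNat f 7]

theorem map_cubic_iterate {S : Type*} [CommRing S] (f : R →+* S) (n : ℕ) (x : R) :
    f (cubic^[n] x) = cubic^[n] (f x) :=
  (Function.Semiconj.iterate_right (f := f) (map_cubic f) n) x

theorem cubic_iterate_zero {n : ℕ} (hn : n ≠ 0) : cubic^[n] (0 : R) = -7 := by
  induction n, Nat.one_le_iff_ne_zero.mpr hn using Nat.le_induction with
  | base => simp [cubic]
  | succ n hn ih =>
    rw [Function.iterate_succ_apply', ih (by lia), cubic]
    ring

theorem cubic_iterate_add_seven (n : ℕ) (x : R) :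
    cubic^[n] x + 7 = (x + 7) * (∏ j ∈ Finset.range n, cubic^[j] x) ^ 2 := by
  induction n with
  | zero => simp
  | succ n ih =>
    rw [Finset.prod_range_succ, mul_pow, ← mul_assoc, ← ih, Function.iterate_succ_apply', cubic]
    ring

end Iterates

theorem cubicPoly_monic : cubicPoly.Monic := by
  unfold cubicPoly
  monicity!

theorem cubicPoly_natDegree : cubicPoly.natDegree = 3 := by
  unfold cubicPoly
  compute_degree!

theorem polyIter_natDegree (n : ℕ) : (polyIter cubicPoly n).natDegree = 3 ^ n := by
  induction n with
  | zero => simp [polyIter]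
  | succ n ih => rw [polyIter, natDegree_comp, ih, cubicPoly_natDegree, pow_succ']

theorem polyIter_monic (n : ℕ) : (polyIter cubicPoly n).Monic := by
  induction n with
  | zero => exact monic_X
  | succ n ih => exact cubicPoly_monic.comp ih (by rw [polyIter_natDegree]; positivity)

theorem map_polyIter_zmod_seven (n : ℕ) :
    (polyIter cubicPoly n).map (Int.castRingHom (ZMod 7)) = X ^ 3 ^ n := by
  induction n with
  | zero => simp [polyIter]
  | succ n ih =>
    have h7 : (7 : (ZMod 7)[X]) = 0 := CharP.cast_eq_zero (ZMod 7)[X] 7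
    rw [polyIter, map_comp, ih]
    simp [cubicPoly, h7, pow_succ 3, pow_mul]

theorem polyIter_irreducible (n : ℕ) : Irreducible (polyIter cubicPoly n) := by
  rcases eq_or_ne n 0 with rfl | hn
  · exact irreducible_X
  have h7 : Prime (7 : ℤ) := Int.prime_iff_natAbs_prime.mpr (by norm_num)
  have h0 : (polyIter cubicPoly n).coeff 0 = -7 := by
    rw [coeff_zero_eq_aeval_zero, aeval_polyIter, cubic_iterate_zero hn]
  refine IsEisensteinAt.irreducible (𝓟 := Ideal.span {7}) ⟨?_, ?_, ?_⟩
    ((Ideal.span_singleton_prime h7.ne_zero).mpr h7) (polyIter_monic n).isPrimitive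
    (by rw [polyIter_natDegree]; positivity)
  · rw [(polyIter_monic n).leadingCoeff, Ideal.mem_span_singleton]
    exact fun h ↦ h7.not_isUnit (isUnit_of_dvd_one h)
  · intro i hi
    have h := congrArg (fun q ↦ q.coeff i) (map_polyIter_zmod_seven n)
    rw [polyIter_natDegree] at hi
    simp only [coeff_map, coeff_X_pow, hi.ne, if_false, eq_intCast] at h
    rw [Ideal.mem_span_singleton]
    exact_mod_cast (ZMod.intCast_zmod_eq_zero_iff_dvd _ 7).mp h
  · rw [h0, Ideal.span_singleton_pow, Ideal.mem_span_singleton]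
    norm_num

theorem map_polyIter_irreducible (n : ℕ) :
    Irreducible ((polyIter cubicPoly n).map (Int.castRingHom ℚ)) :=
  ((polyIter_monic n).irreducible_iff_irreducible_map_fraction_map (K := ℚ)).mp
    (polyIter_irreducible n)

section CriticalOrbit

/-- The denominators `27 ^ 3 ^ n` of the orbit of the critical value `1183 / 27`. -/
def critDen (n : ℕ) : ℤ := 27 ^ 3 ^ n

/-- The numerators, divided by `7`, of the orbit of the critical value `1183 / 27`. -/
def critNum : ℕ → ℤ
  | 0 => 169
  | n + 1 => 49 * critNum n ^ 3 + 49 * critNum n ^ 2 * critDen n - critDen n ^ 3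

theorem critDen_succ (n : ℕ) : critDen (n + 1) = critDen n ^ 3 := by
  rw [critDen, critDen, ← pow_mul, pow_succ]

theorem critDen_mul_cubic_iterate {R : Type*} [CommRing R] {c : R} (hc : 27 * c = 1183) (n : ℕ) :
    critDen n * cubic^[n] c = 7 * critNum n := by
  induction n with
  | zero =>
    simp only [critDen, critNum, Function.iterate_zero, id]
    push_cast
    linear_combination hc
  | succ n ih =>
    rw [critDen_succ, critNum, Function.iterate_succ_apply', cubic]
    push_cast
    generalize (critDen n : R) = E at *
    generalize (critNum n : R) = B at *
    generalize cubic^[n] c = y at *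
    linear_combination (E ^ 2 * y ^ 2 + E * y * (7 * B) + 49 * B ^ 2 + 7 * E * (E * y + 7 * B)) * ih

theorem critDen_pos (n : ℕ) : 0 < critDen n := by
  unfold critDen
  positivity

theorem critDen_le_critNum (n : ℕ) : critDen n ≤ critNum n := by
  induction n with
  | zero => norm_num [critDen, critNum]
  | succ n ih =>
    have h := critDen_pos n
    have h2 : critDen n ^ 2 ≤ critNum n ^ 2 := by gcongr
    have h3 : critDen n ^ 3 ≤ critNum n ^ 3 := by gcongr
    rw [critDen_succ, critNum]
    nlinarith [mul_le_mul_of_nonneg_right h2 h.le, pow_pos h 3]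

theorem critNum_pos (n : ℕ) : 0 < critNum n :=
  (critDen_pos n).trans_le (critDen_le_critNum n)

theorem not_three_dvd_critNum (n : ℕ) : ¬ (3 : ℤ) ∣ critNum n := by
  induction n with
  | zero => norm_num [critNum]
  | succ n ih =>
    have hp : Prime (3 : ℤ) := Int.prime_three
    have hd : (3 : ℤ) ∣ critDen n := dvd_pow (by norm_num) (by positivity)
    intro h
    rw [critNum] at h
    have h1 : (3 : ℤ) ∣ 49 * critNum n ^ 3 := by
      have := dvd_add h (hd.mul_right (critDen n ^ 2 - 49 * critNum n ^ 2))
      ring_nf at this ⊢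
      exact this
    rcases hp.dvd_or_dvd h1 with h2 | h2
    · norm_num at h2
    · exact ih (hp.dvd_of_dvd_pow h2)

theorem not_seven_dvd_critNum (n : ℕ) : ¬ (7 : ℤ) ∣ critNum n := by
  cases n with
  | zero => norm_num [critNum]
  | succ n =>
    have hp : Prime (7 : ℤ) := Int.prime_iff_natAbs_prime.mpr (by norm_num)
    intro h
    rw [critNum] at h
    have h1 : (7 : ℤ) ∣ critDen n ^ 3 := by
      have := dvd_sub
        (dvd_mul_right (7 : ℤ) (7 * critNum n ^ 3 + 7 * critNum n ^ 2 * critDen n)) h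
      ring_nf at this ⊢
      exact this
    have h2 := hp.dvd_of_dvd_pow (hp.dvd_of_dvd_pow h1)
    norm_num at h2

theorem critNum_not_isSquare {n : ℕ} (hn : n ≠ 0) : ¬ IsSquare (critNum n) := by
  have h57 : ∀ z : ZMod 67, z ^ 2 ≠ 57 := by decide
  have h3 : (3 : ZMod 67) ≠ 0 := by decide
  have h19 : (49 * 19 ^ 3 + 49 * 19 ^ 2 - 1 : ZMod 67) = 19 := by decide
  have hbase : (critNum 1 : ZMod 67) = 19 * critDen 1 := by simp only [critNum, critDen]; decide
  have : Fact (Nat.Prime 67) := ⟨by norm_num⟩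
  have hden : ∀ k, ∃ s : ZMod 67, s ≠ 0 ∧ (critDen k : ZMod 67) = 3 * s ^ 2 := by
    intro k
    induction k with
    | zero => exact ⟨3, h3, by norm_num [critDen]⟩
    | succ k ih =>
      obtain ⟨s, hs, h⟩ := ih
      refine ⟨3 * s ^ 3, mul_ne_zero h3 (pow_ne_zero _ hs), ?_⟩
      rw [critDen_succ]
      push_cast
      rw [h]
      ring
  have hnum : ∀ k, (critNum (k + 1) : ZMod 67) = 19 * critDen (k + 1) := by
    intro k
    induction k with
    | zero => exact hbase
    | succ k ih =>
      rw [critNum, critDen_succ (k + 1)]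
      push_cast
      rw [ih]
      generalize (critDen (k + 1) : ZMod 67) = E
      linear_combination E ^ 3 * h19
  obtain ⟨k, rfl⟩ := Nat.exists_eq_succ_of_ne_zero hn
  rintro ⟨r, hr⟩
  obtain ⟨s, hs, h⟩ := hden (k + 1)
  have h1 : (r : ZMod 67) * r = 57 * s ^ 2 := by
    have := hnum k
    rw [h, show critNum (k + 1) = r * r from hr] at this
    push_cast at this
    rw [this]
    ring
  have h2 : (r / s : ZMod 67) ^ 2 = 57 := by
    rw [div_pow, sq (r : ZMod 67), h1, mul_div_cancel_right₀ _ (pow_ne_zero 2 hs)]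
  exact h57 _ h2

theorem Nat.exists_prime_pow_mul_of_not_isSquare {n : ℕ} (hn : ¬ IsSquare n) :
    ∃ p k m : ℕ, p.Prime ∧ Odd k ∧ ¬ p ∣ m ∧ n = p ^ k * m := by
  have hn0 : n ≠ 0 := by
    rintro rfl
    exact hn (IsSquare.zero)
  obtain ⟨a, b, hab, ha⟩ := Nat.sq_mul_squarefree n
  have ha1 : a ≠ 1 := by
    rintro rfl
    exact hn ⟨b, by rw [← hab]; ring⟩
  obtain ⟨p, hp, c, rfl⟩ := Nat.exists_prime_and_dvd ha1
  have hpc : ¬ p ∣ c := by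
    rintro ⟨d, rfl⟩
    exact hp.not_isUnit (ha p ⟨d, by ring⟩)
  have hb : b ≠ 0 := by
    rintro rfl
    simp at hab
    exact hn0 hab.symm
  obtain ⟨j, e, he, rfl⟩ := Nat.exists_eq_pow_mul_and_not_dvd hb p hp.ne_one
  refine ⟨p, 2 * j + 1, e ^ 2 * c, hp, ⟨j, rfl⟩, ?_, by rw [← hab]; ring⟩
  intro h
  rcases hp.dvd_mul.mp h with h | h
  · exact he (hp.dvd_of_dvd_pow h)
  · exact hpc h

theorem exists_prime_critNum {n : ℕ} (hn : n ≠ 0) :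
    ∃ p k m : ℕ, p.Prime ∧ Odd k ∧ ¬ p ∣ m ∧ p ≠ 3 ∧ p ≠ 7 ∧ critNum n = p ^ k * m := by
  have hz : ((critNum n).toNat : ℤ) = critNum n := Int.toNat_of_nonneg (critNum_pos n).le
  obtain ⟨p, k, m, hp, hk, hm, h⟩ := Nat.exists_prime_pow_mul_of_not_isSquare
    (n := (critNum n).toNat) (fun ⟨r, hr⟩ ↦ critNum_not_isSquare hn ⟨r, by rw [← hz, hr]; simp⟩)
  have h' : critNum n = p ^ k * m := by
    rw [← hz, h]
    push_cast
    rfl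
  have hdvd : (p : ℤ) ∣ critNum n := by
    rw [h']
    exact (dvd_pow_self _ hk.pos.ne').mul_right _
  refine ⟨p, k, m, hp, hk, hm, ?_, ?_, h'⟩
  · rintro rfl
    exact not_three_dvd_critNum n (by exact_mod_cast hdvd)
  · rintro rfl
    exact not_seven_dvd_critNum n (by exact_mod_cast hdvd)

end CriticalOrbit

theorem eval_derivative_polyIter {R : Type*} [CommRing R] (n : ℕ) (x : R) :
    ((derivative (polyIter cubicPoly n)).map (Int.castRingHom R)).eval x =
      ∏ j ∈ Finset.range n, (cubic^[j] x * (3 * cubic^[j] x + 14)) := by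
  induction n with
  | zero => simp [polyIter]
  | succ n ih =>
    rw [Finset.prod_range_succ, ← ih, polyIter, derivative_comp, Polynomial.map_mul, eval_mul,
      map_comp, eval_comp, eval_map_polyIter]
    congr 1
    simp [cubicPoly]
    ring

/-- If the critical value `1183 / 27` is a root of the `n`-th iterate of `X³ + 7X² - 7` over an
algebraically closed field in which `21 ≠ 0`, then this iterate is separable. -/
theorem separable_map_polyIter {k : Type*} [Field k] [IsAlgClosed k] (h3 : (3 : k) ≠ 0)
    (h7 : (7 : k) ≠ 0) {c : k} (hc : 27 * c = 1183) {n : ℕ} (hroot : cubic^[n] c = 0) :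
    ((polyIter cubicPoly n).map (Int.castRingHom k)).Separable := by
  rw [Separable, isCoprime_iff_aeval_ne_zero_of_isAlgClosed k k]
  intro x
  rw [or_iff_not_imp_left, not_not, coe_aeval_eq_eval, eval_map_polyIter,
    derivative_map, eval_derivative_polyIter, Finset.prod_ne_zero_iff]
  intro hx j hj h0
  rw [Finset.mem_range] at hj
  have hx' : cubic^[n - j] (cubic^[j] x) = 0 := by
    rw [← Function.iterate_add_apply, Nat.sub_add_cancel hj.le, hx]
  rcases mul_eq_zero.mp h0 with h | h
  · rw [h, cubic_iterate_zero (by lia), neg_eq_zero] at hx'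
    exact h7 hx'
  · have h27 : (27 : k) ≠ 0 := by
      have : (27 : k) = 3 ^ 3 := by norm_num
      rw [this]
      exact pow_ne_zero 3 h3
    have hcrit : cubic (cubic^[j] x) = c := by
      apply mul_left_cancel₀ h27
      rw [hc, cubic]
      linear_combination (9 * (cubic^[j] x) ^ 2 + 21 * cubic^[j] x - 98) * h
    rw [show n - j = n - j - 1 + 1 by lia, Function.iterate_succ_apply, hcrit] at hx'
    have h2 : cubic^[j + 1] (cubic^[n - j - 1] c) = 0 := by
      rw [← Function.iterate_add_apply, show j + 1 + (n - j - 1) = n by lia, hroot]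
    rw [hx', cubic_iterate_zero (by lia), neg_eq_zero] at h2
    exact h7 h2

theorem Polynomial.Monic.eq_prod_X_sub_C_of_injective {R ι : Type*} [CommRing R] [IsDomain R]
    [Fintype ι] {f : R[X]} (hf : f.Monic) {r : ι → R} (hr : Function.Injective r)
    (hroot : ∀ i, f.IsRoot (r i)) (hcard : f.natDegree = Fintype.card ι) :
    f = ∏ i, (X - C (r i)) := by
  have hle : Finset.univ.val.map r ≤ f.roots :=
    (Multiset.le_iff_subset (Finset.univ.nodup.map hr)).mpr fun x hx ↦ by
      obtain ⟨i, -, rfl⟩ := Multiset.mem_map.mp hx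
      exact (mem_roots hf.ne_zero).mpr (hroot i)
  have heq : Finset.univ.val.map r = f.roots :=
    Multiset.eq_of_le_of_card_le hle (by simpa [← hcard] using f.card_roots')
  have hprod := prod_multiset_X_sub_C_of_monic_of_roots_card_eq hf (by rw [← heq, hcard]; simp)
  rw [← hprod, ← heq, Multiset.map_map]
  rfl

section WittVector

variable {p : ℕ} [Fact p.Prime] {k : Type*} [Field k] [CharP k p]

theorem WittVector.charZero_of_field : CharZero (WittVector p k) := by
  obtain ⟨q, hq⟩ := CharP.exists (WittVector p k)
  rcases CharP.char_is_prime_or_zero (WittVector p k) q with h | rfl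
  · have h0 : ((q : ℕ) : k) = 0 := by
      rw [← map_natCast (WittVector.constantCoeff (p := p) (R := k)), CharP.cast_eq_zero, map_zero]
    rw [CharP.cast_eq_zero_iff k p, Nat.prime_dvd_prime_iff_eq Fact.out h] at h0
    subst h0
    exact absurd (CharP.cast_eq_zero (WittVector p k) p) (WittVector.p_nonzero p k)
  · exact CharP.charP_to_charZero _

theorem WittVector.isUnit_of_constantCoeff_ne_zero {x : WittVector p k}
    (hx : WittVector.constantCoeff x ≠ 0) : IsUnit x :=
  WittVector.isUnit_of_coeff_zero_ne_zero x hx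

/-- Over the Witt vectors of an algebraically closed field, a monic polynomial with separable
reduction splits. -/
theorem WittVector.splits_of_separable_map [IsAlgClosed k] {f : (WittVector p k)[X]}
    (hf : f.Monic) (hsep : (f.map WittVector.constantCoeff).Separable) : f.Splits := by
  classical
  set g := f.map (WittVector.constantCoeff (p := p) (R := k)) with hg
  have hlift : ∀ ρ : g.roots.toFinset, ∃ a : WittVector p k, f.IsRoot a ∧
      WittVector.constantCoeff a = (ρ : k) := by
    rintro ⟨ρ, hρ⟩
    rw [Multiset.mem_toFinset, mem_roots (hf.map _).ne_zero, IsRoot] at hρ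
    obtain ⟨a₀, rfl⟩ := WittVector.constantCoeff_surjective (R := k) p ρ
    have hder : WittVector.constantCoeff (f.derivative.eval a₀) ≠ 0 := by
      rw [← eval_map_apply, ← derivative_map]
      exact hsep.eval₂_derivative_ne_zero (RingHom.id k) (by simpa using hρ)
    obtain ⟨a, ha, hmem⟩ := HenselianRing.is_henselian (I := Ideal.span {(p : WittVector p k)}) f hf
      a₀ (by
        rw [← WittVector.ker_constantCoeff, RingHom.mem_ker, ← eval_map_apply]
        exact hρ)
      ((WittVector.isUnit_of_constantCoeff_ne_zero hder).map _)
    refine ⟨a, ha, ?_⟩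
    rw [← WittVector.ker_constantCoeff, RingHom.mem_ker, map_sub, sub_eq_zero] at hmem
    exact hmem
  choose τ hτ hτ' using hlift
  have hinj : Function.Injective τ := fun a b h ↦ Subtype.ext (by rw [← hτ' a, ← hτ' b, h])
  rw [hf.eq_prod_X_sub_C_of_injective hinj hτ]
  · exact Splits.prod fun i _ ↦ Splits.X_sub_C _
  · rw [Fintype.card_coe, Multiset.toFinset_card_of_nodup (nodup_roots hsep),
      ← (IsAlgClosed.splits g).natDegree_eq_card_roots, hg, hf.natDegree_map]

end WittVector

theorem isAlgebraic_rat_algebraicClosure : Algebra.IsAlgebraic ℚ (AlgebraicClosure ℚ) := by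
  rw [Subsingleton.elim DivisionRing.toRatAlgebra (AlgebraicClosure.instAlgebra ℚ)]
  exact AlgebraicClosure.isAlgebraic ℚ

theorem isGalois_rat_algebraicClosure : IsGalois ℚ (AlgebraicClosure ℚ) := by
  have := isAlgebraic_rat_algebraicClosure
  have : Normal ℚ (AlgebraicClosure ℚ) := normal_iff.mpr fun x ↦
    ⟨Algebra.IsIntegral.isIntegral x, IsAlgClosed.splits _⟩
  exact ⟨⟩

theorem mem_rootSet_polyIter {R : Type*} [CommRing R] [IsDomain R] [Algebra ℤ R] {n : ℕ} {x : R} :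
    x ∈ (polyIter cubicPoly n).rootSet R ↔ cubic^[n] x = 0 := by
  rw [mem_rootSet', aeval_polyIter, and_iff_right ((polyIter_monic n).map _).ne_zero]

theorem mem_Kfield_of_root {n : ℕ} {x : AlgebraicClosure ℚ} (hx : cubic^[n] x = 0) :
    x ∈ Kfield cubicPoly n :=
  IntermediateField.subset_adjoin _ _ (mem_rootSet_polyIter.mpr hx)

theorem minpoly_eq_of_root {L : Type*} [Field L] [Algebra ℚ L] {n : ℕ} {x : L}
    (hx : cubic^[n] x = 0) :
    minpoly ℚ x = (polyIter cubicPoly n).map (Int.castRingHom ℚ) := by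
  refine (minpoly.eq_of_irreducible_of_monic (map_polyIter_irreducible n) ?_
    ((polyIter_monic n).map _)).symm
  rw [← algebraMap_int_eq, aeval_map_algebraMap, aeval_polyIter, hx]

theorem card_rootSet_polyIter (n : ℕ) :
    Fintype.card ((polyIter cubicPoly n).rootSet (AlgebraicClosure ℚ)) = 3 ^ n := by
  have h := card_rootSet_eq_natDegree (K := AlgebraicClosure ℚ)
    (map_polyIter_irreducible n).separable (IsAlgClosed.splits _)
  rw [(polyIter_monic n).natDegree_map, polyIter_natDegree] at h
  rw [← h, ← Nat.card_eq_fintype_card, ← Nat.card_eq_fintype_card, rootSet, rootSet, aroots,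
    aroots, Polynomial.map_map]
  congr!

/-- The quadratic independence of the discriminants of the fibres, in terms of a local domain `W` of
characteristic zero over which `p` is prime and monic polynomials with separable reduction split. -/
theorem exists_root_forall_sq_ne_prod_of_local {m : ℕ} {W k : Type} [CommRing W] [IsDomain W]
    [CharZero W] [IsIntegrallyClosed W] [Field k] [IsAlgClosed k] (π : W →+* k)
    (hπ : ∀ x, π x ≠ 0 → IsUnit x) (hsplit : ∀ f : W[X], f.Monic → (f.map π).Separable → f.Splits)
    {p e u : ℕ} (hprime : Prime (p : W)) (hπp : π p = 0) (he : Odd e) (hu : (u : k) ≠ 0)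
    (h3k : (3 : k) ≠ 0) (h7k : (7 : k) ≠ 0) (hnum : critNum m = p ^ e * u) :
    ∃ t₀ : AlgebraicClosure ℚ, cubic^[m] t₀ = 0 ∧
      ∀ S : Finset (AlgebraicClosure ℚ), (∀ t ∈ S, cubic^[m] t = 0) → t₀ ∈ S →
        ∀ y ∈ Kfield cubicPoly m, y ^ 2 ≠ ∏ t ∈ S, (t + 7) * (1183 - 27 * t) := by
  classical
  let F := FractionRing W
  have : CharZero F := IsFractionRing.charZero_of_isFractionRing W
  have h7W : IsUnit (7 : W) := hπ _ (by rwa [map_ofNat])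
  have h27W : IsUnit (27 : W) := by
    rw [show (27 : W) = 3 ^ 3 by norm_num]
    exact (hπ _ (by rwa [map_ofNat])).pow 3
  have huW : IsUnit (u : W) := hπ _ (by rwa [map_natCast])
  have hp0 : (p : W) ≠ 0 := hprime.ne_zero
  obtain ⟨c, hc⟩ : ∃ c : W, 27 * c = 1183 := by
    obtain ⟨v, hv⟩ := h27W.exists_right_inv
    exact ⟨v * 1183, by rw [← mul_assoc, hv, one_mul]⟩
  have hden : IsUnit ((critDen m : ℤ) : W) := by
    rw [critDen]
    push_cast
    exact h27W.pow _
  have hval : ∃ v : W, IsUnit v ∧ cubic^[m] c = p ^ e * v := by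
    obtain ⟨w, hw⟩ := hden.exists_left_inv
    have h := critDen_mul_cubic_iterate hc m
    refine ⟨w * (7 * u), (IsUnit.of_mul_eq_one _ hw).mul (h7W.mul huW), ?_⟩
    rw [hnum] at h
    push_cast at h
    linear_combination w * h - cubic^[m] c * hw
  have hredc : cubic^[m] (π c) = 0 := by
    obtain ⟨v, -, hv⟩ := hval
    rw [← map_cubic_iterate, hv, map_mul, map_pow, hπp, zero_pow he.pos.ne', zero_mul]
  have hsep := separable_map_polyIter h3k h7k (c := π c)
    (by rw [← map_ofNat π 27, ← map_mul, hc, map_ofNat]) hredc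
  have hmapmap : ((polyIter cubicPoly m).map (Int.castRingHom W)).map π =
      (polyIter cubicPoly m).map (Int.castRingHom k) := by
    rw [Polynomial.map_map]
    congr 1
    exact RingHom.ext_int _ _
  have hsplitW : ((polyIter cubicPoly m).map (Int.castRingHom W)).Splits :=
    hsplit _ ((polyIter_monic m).map _) (by rw [hmapmap]; exact hsep)
  have hsplitF : (((polyIter cubicPoly m).map (Int.castRingHom ℚ)).map (algebraMap ℚ F)).Splits := by
    have h := hsplitW.map (algebraMap W F)
    rw [Polynomial.map_map] at h ⊢
    convert h using 2
    exact RingHom.ext_int _ _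
  obtain ⟨ι⟩ : Nonempty (Kfield cubicPoly m →ₐ[ℚ] F) := by
    refine IntermediateField.nonempty_algHom_adjoin_of_splits fun s hs ↦ ?_
    rw [mem_rootSet_polyIter] at hs
    have := isAlgebraic_rat_algebraicClosure
    exact ⟨Algebra.IsIntegral.isIntegral s, by rw [minpoly_eq_of_root hs]; exact hsplitF⟩
  have hιroot : ∀ t : (polyIter cubicPoly m).rootSet (AlgebraicClosure ℚ),
      cubic^[m] (ι ⟨t, mem_Kfield_of_root (mem_rootSet_polyIter.mp t.2)⟩) = 0 := by
    intro t
    have h0 : cubic^[m] (⟨t, mem_Kfield_of_root (mem_rootSet_polyIter.mp t.2)⟩ :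
        Kfield cubicPoly m) = 0 := by
      apply (algebraMap (Kfield cubicPoly m) (AlgebraicClosure ℚ)).injective
      rw [map_cubic_iterate, map_zero]
      exact mem_rootSet_polyIter.mp t.2
    have h1 := map_cubic_iterate (ι : Kfield cubicPoly m →+* F) m
      ⟨t, mem_Kfield_of_root (mem_rootSet_polyIter.mp t.2)⟩
    rw [h0, map_zero] at h1
    exact h1.symm
  have hlift : ∀ t : (polyIter cubicPoly m).rootSet (AlgebraicClosure ℚ), ∃ τ : W,
      algebraMap W F τ = ι ⟨t, mem_Kfield_of_root (mem_rootSet_polyIter.mp t.2)⟩ := by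
    intro t
    refine IsIntegrallyClosed.isIntegral_iff.mp
      ⟨(polyIter cubicPoly m).map (Int.castRingHom W), (polyIter_monic m).map _, ?_⟩
    rw [eval₂_eq_eval_map, Polynomial.map_map,
      show (algebraMap W F).comp (Int.castRingHom W) = Int.castRingHom F from RingHom.ext_int _ _,
      eval_map_polyIter, hιroot]
  choose τ hτ using hlift
  have hτinj : Function.Injective τ := fun a b h ↦ by
    have h1 : ι _ = ι _ := (hτ a).symm.trans ((congrArg _ h).trans (hτ b))
    exact Subtype.ext (Subtype.mk.inj (ι.injective h1))
  have hτroot : ∀ t, cubic^[m] (τ t) = 0 := by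
    intro t
    apply IsFractionRing.injective W F
    rw [map_cubic_iterate, map_zero, hτ, hιroot]
  have hfac : (polyIter cubicPoly m).map (Int.castRingHom W) = ∏ t, (X - C (τ t)) := by
    refine ((polyIter_monic m).map _).eq_prod_X_sub_C_of_injective hτinj (fun t ↦ ?_) ?_
    · rw [IsRoot, eval_map_polyIter, hτroot]
    · rw [(polyIter_monic m).natDegree_map, polyIter_natDegree, card_rootSet_polyIter]
  have hredinj : Function.Injective fun t ↦ π (τ t) := by
    rw [← separable_prod_X_sub_C_iff]
    rw [← hmapmap, hfac, Polynomial.map_prod] at hsep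
    simpa using hsep
  have hprodc : ∏ t, (c - τ t) = cubic^[m] c := by
    rw [← eval_map_polyIter, hfac, eval_prod]
    simp
  obtain ⟨t₀, ht₀⟩ : ∃ t₀, π (c - τ t₀) = 0 := by
    have h := congrArg π hprodc
    rw [map_prod, map_cubic_iterate, hredc, Finset.prod_eq_zero_iff] at h
    obtain ⟨t₀, -, h⟩ := h
    exact ⟨t₀, h⟩
  have hother : ∀ t, t ≠ t₀ → IsUnit (c - τ t) := by
    intro t ht
    refine hπ _ fun h ↦ ht (hredinj ?_)
    rw [map_sub, sub_eq_zero] at ht₀ h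
    exact h.symm.trans ht₀
  have hval₀ : ∃ v : W, IsUnit v ∧ c - τ t₀ = p ^ e * v := by
    obtain ⟨v, hv, h⟩ := hval
    rw [← hprodc, ← Finset.mul_prod_erase _ _ (Finset.mem_univ t₀)] at h
    have hun : IsUnit (∏ t ∈ Finset.univ.erase t₀, (c - τ t)) :=
      IsUnit.prod_iff.mpr fun t ht ↦ hother t (Finset.ne_of_mem_erase ht)
    obtain ⟨w, hw⟩ := hun.exists_right_inv
    refine ⟨v * w, hv.mul (IsUnit.of_mul_eq_one_right _ hw), ?_⟩
    linear_combination w * h - (c - τ t₀) * hw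
  have hadd : ∀ t, IsUnit (τ t + 7) := by
    intro t
    have h := cubic_iterate_add_seven m (τ t)
    rw [hτroot, zero_add] at h
    exact isUnit_of_mul_isUnit_left (h ▸ h7W)
  have hdisc : ∀ t, (τ t + 7) * (1183 - 27 * τ t) = (27 * (τ t + 7)) * (c - τ t) := by
    intro t
    rw [← hc]
    ring
  refine ⟨t₀, mem_rootSet_polyIter.mp t₀.2, fun S hS ht₀S y hy hsq ↦ ?_⟩
  let S' : Finset ((polyIter cubicPoly m).rootSet (AlgebraicClosure ℚ)) := S.subtype _
  have hιsq : (ι ⟨y, hy⟩) ^ 2 = algebraMap W F (∏ t ∈ S', (τ t + 7) * (1183 - 27 * τ t)) := by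
    have hterm : ∀ t, algebraMap W F ((τ t + 7) * (1183 - 27 * τ t)) =
        ι ((⟨t, mem_Kfield_of_root (mem_rootSet_polyIter.mp t.2)⟩ + 7) *
          (1183 - 27 * ⟨t, mem_Kfield_of_root (mem_rootSet_polyIter.mp t.2)⟩)) := fun t ↦ by
      simp only [map_mul, map_add, map_sub, map_ofNat, hτ]
    rw [map_prod, ← map_pow, Finset.prod_congr rfl fun t _ ↦ hterm t, ← map_prod]
    congr 1
    apply (algebraMap (Kfield cubicPoly m) (AlgebraicClosure ℚ)).injective
    rw [map_pow, map_prod]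
    refine hsq.trans ?_
    rw [← Finset.prod_subtype_of_mem _ fun t ht ↦ mem_rootSet_polyIter.mpr (hS t ht)]
    rfl
  obtain ⟨z, hz⟩ := IsIntegrallyClosed.exists_algebraMap_eq_of_isIntegral_pow (R := W)
    (x := ι ⟨y, hy⟩) two_pos (by rw [hιsq]; exact isIntegral_algebraMap)
  rw [← hz, ← map_pow] at hιsq
  have hzsq := IsFractionRing.injective W F hιsq
  have hmem : t₀ ∈ S' := by simpa [S'] using ht₀S
  have hfin : ∃ w : W, IsUnit w ∧ z ^ 2 = p ^ e * w := by
    obtain ⟨v, hv, h⟩ := hval₀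
    rw [← Finset.mul_prod_erase _ _ hmem, hdisc, h] at hzsq
    refine ⟨27 * (τ t₀ + 7) * v * ∏ t ∈ S'.erase t₀, (τ t + 7) * (1183 - 27 * τ t),
      ((h27W.mul (hadd t₀)).mul hv).mul (IsUnit.prod_iff.mpr fun t ht ↦ ?_), ?_⟩
    · rw [hdisc]
      exact (h27W.mul (hadd t)).mul (hother t (Finset.ne_of_mem_erase ht))
    · rw [hzsq]
      ring
  obtain ⟨w, hw, hzw⟩ := hfin
  have h1 : emultiplicity (p : W) (z ^ 2) = e := by
    rw [hzw, emultiplicity_mul hprime, emultiplicity_pow_self hp0 hprime.not_isUnit,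
      emultiplicity_of_isUnit_right hprime.not_isUnit hw, add_zero]
  rw [emultiplicity_pow hprime] at h1
  obtain ⟨a, ha⟩ := ENat.ne_top_iff_exists.mp (show emultiplicity (p : W) z ≠ ⊤ by
    intro htop
    rw [htop] at h1
    simp at h1)
  rw [← ha] at h1
  obtain ⟨j, rfl⟩ := he
  norm_cast at h1
  lia

theorem exists_root_forall_sq_ne_prod {m : ℕ} (hm : m ≠ 0) :
    ∃ t₀ : AlgebraicClosure ℚ, cubic^[m] t₀ = 0 ∧
      ∀ S : Finset (AlgebraicClosure ℚ), (∀ t ∈ S, cubic^[m] t = 0) → t₀ ∈ S →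
        ∀ y ∈ Kfield cubicPoly m, y ^ 2 ≠ ∏ t ∈ S, (t + 7) * (1183 - 27 * t) := by
  obtain ⟨p, e, u, hp, he, hu, hp3, hp7, hnum⟩ := exists_prime_critNum hm
  have : Fact p.Prime := ⟨hp⟩
  have : CharZero (WittVector p (AlgebraicClosure (ZMod p))) := WittVector.charZero_of_field
  have hnat : ∀ n : ℕ, ¬ p ∣ n → (n : AlgebraicClosure (ZMod p)) ≠ 0 := fun n hn h ↦
    hn ((CharP.cast_eq_zero_iff _ p n).mp h)
  have h3 := hnat 3 fun h ↦ hp3 ((Nat.prime_dvd_prime_iff_eq hp Nat.prime_three).mp h)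
  have h7 := hnat 7 fun h ↦ hp7 ((Nat.prime_dvd_prime_iff_eq hp (by norm_num)).mp h)
  exact exists_root_forall_sq_ne_prod_of_local WittVector.constantCoeff
    (fun _ ↦ WittVector.isUnit_of_constantCoeff_ne_zero)
    (fun _ ↦ WittVector.splits_of_separable_map) (WittVector.irreducible p).prime
    (by rw [map_natCast, CharP.cast_eq_zero]) he (hnat u hu) (by exact_mod_cast h3)
    (by exact_mod_cast h7) hnum

/-- In a Galois extension, a family of elements that every automorphism fixes up to sign, such that
no subproduct through `i₀` lies in the base field, admits an automorphism changing the sign of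
exactly the `i₀`-th element. -/
theorem exists_algEquiv_neg_of_forall_prod_notMem {K L I : Type*} [Field K] [Field L] [Algebra K L]
    [IsGalois K L] [Fintype I] [DecidableEq I] (d : I → L)
    (hd : ∀ (σ : L ≃ₐ[K] L) i, σ (d i) = d i ∨ σ (d i) = -d i) (i₀ : I)
    (h : ∀ S : Finset I, i₀ ∈ S → ∏ i ∈ S, d i ∉ (⊥ : IntermediateField K L)) :
    ∃ σ : L ≃ₐ[K] L, σ (d i₀) = -d i₀ ∧ ∀ i ≠ i₀, σ (d i) = d i := by
  let ε : ZMod 2 → L := fun a ↦ if a = 0 then 1 else -1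
  have h01 : ∀ a : ZMod 2, a = 0 ∨ a = 1 := by decide
  have h11 : (1 + 1 : ZMod 2) = 0 := by decide
  have hε : ∀ a b, ε (a + b) = ε a * ε b := by
    intro a b
    rcases h01 a with rfl | rfl <;> rcases h01 b with rfl | rfl <;> simp [ε, h11]
  have hεσ : ∀ (σ : L ≃ₐ[K] L) a, σ (ε a) = ε a := by
    intro σ a
    rcases h01 a with rfl | rfl <;> simp [ε]
  let W : Submodule (ZMod 2) (I → ZMod 2) :=
    { carrier := {v | ∃ σ : L ≃ₐ[K] L, ∀ i, σ (d i) = ε (v i) * d i}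
      add_mem' := by
        rintro v w ⟨σ, hσ⟩ ⟨τ, hτ⟩
        refine ⟨σ * τ, fun i ↦ ?_⟩
        rw [AlgEquiv.mul_apply, hτ, map_mul, hεσ, hσ, Pi.add_apply, hε]
        ring
      zero_mem' := ⟨1, fun i ↦ by simp [ε]⟩
      smul_mem' := by
        rintro c v ⟨σ, hσ⟩
        rcases h01 c with rfl | rfl
        · exact ⟨1, fun i ↦ by simp [ε]⟩
        · exact ⟨σ, fun i ↦ by simpa using hσ i⟩ }
  by_cases hW : Pi.single i₀ 1 ∈ W
  · obtain ⟨σ, hσ⟩ := hW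
    exact ⟨σ, by simpa [ε] using hσ i₀, fun i hi ↦ by simpa [ε, hi] using hσ i⟩
  · obtain ⟨f, hf, hWf⟩ := Submodule.exists_le_ker_of_notMem hW
    exfalso
    let S : Finset I := {i | f (Pi.single i 1) ≠ 0}
    refine h S (by simpa [S] using hf) ((InfiniteGalois.mem_bot_iff_fixed _).mpr fun σ ↦ ?_)
    have hex : ∀ i, ∃ a, σ (d i) = ε a * d i := fun i ↦ by
      rcases hd σ i with h | h
      · exact ⟨0, by simp [ε, h]⟩
      · exact ⟨1, by simp [ε, h]⟩
    choose v hv using hex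
    have hfv : f v = 0 := hWf (show v ∈ W from ⟨σ, hv⟩)
    have hεsum : ∀ (s : Finset I) (g : I → ZMod 2), ε (∑ i ∈ s, g i) = ∏ i ∈ s, ε (g i) := by
      intro s g
      induction s using Finset.induction_on with
      | empty => simp [ε]
      | insert a s ha ih => rw [Finset.sum_insert ha, Finset.prod_insert ha, hε, ih]
    have hsum : f v = ∑ i ∈ S, v i := by
      rw [LinearMap.pi_apply_eq_sum_univ f v, Finset.sum_filter]
      refine Finset.sum_congr rfl fun i _ ↦ ?_
      have hpi : (fun j ↦ if i = j then (1 : ZMod 2) else 0) = Pi.single i 1 := by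
        ext j
        simp [Pi.single_apply, eq_comm]
      rw [hpi]
      split_ifs with hi
      · rw [(h01 _).resolve_left hi, smul_eq_mul, mul_one]
      · rw [not_not.mp hi, smul_zero]
    rw [map_prod, Finset.prod_congr rfl fun i _ ↦ hv i, Finset.prod_mul_distrib, ← hεsum, ← hsum,
      hfv]
    simp [ε]

theorem exists_cubic_fibre {k : Type*} [Field k] [IsAlgClosed k] (h2 : (2 : k) ≠ 0) {t : k}
    (ht : (t + 7) * (1183 - 27 * t) ≠ 0) :
    ∃ r₁ r₂ r₃ : k, r₁ ≠ r₂ ∧ r₁ ≠ r₃ ∧ r₂ ≠ r₃ ∧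
      (∀ x, cubic x = t ↔ x = r₁ ∨ x = r₂ ∨ x = r₃) ∧
      ((r₁ - r₂) * (r₁ - r₃) * (r₂ - r₃)) ^ 2 = (t + 7) * (1183 - 27 * t) := by
  obtain ⟨r, hr⟩ := IsAlgClosed.exists_root (X ^ 3 + 7 * X ^ 2 - C (7 + t) : k[X]) (by
    have : (X ^ 3 + 7 * X ^ 2 - C (7 + t) : k[X]).degree = 3 := by
      rw [show (7 : k[X]) = C 7 from rfl]
      compute_degree!
    rw [this]
    norm_num)
  have hr' : r ^ 3 + 7 * r ^ 2 - 7 = t := by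
    simp only [IsRoot, eval_sub, eval_add, eval_pow, eval_X, eval_mul, eval_C] at hr
    rw [show eval r (7 : k[X]) = 7 from eval_ofNat 7 r] at hr
    linear_combination hr
  obtain ⟨s, hs⟩ := IsAlgClosed.exists_pow_nat_eq (49 - 14 * r - 3 * r ^ 2) two_pos
  obtain ⟨r₂, hr₂⟩ : ∃ r₂, 2 * r₂ = -7 - r + s := ⟨(-7 - r + s) / 2, by field_simp⟩
  obtain ⟨r₃, hr₃⟩ : ∃ r₃, 2 * r₃ = -7 - r - s := ⟨(-7 - r - s) / 2, by field_simp⟩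
  have hsum : r + r₂ + r₃ = -7 := by
    apply mul_left_cancel₀ h2
    linear_combination hr₂ + hr₃
  have hdiff : r₂ - r₃ = s := by
    apply mul_left_cancel₀ h2
    linear_combination hr₂ - hr₃
  have hprod : r * r₂ + r * r₃ + r₂ * r₃ = 0 := by
    apply mul_left_cancel₀ h2
    apply mul_left_cancel₀ h2
    linear_combination 2 * (hr₂ + hr₃) * r + 2 * r₃ * hr₂ + (-7 - r + s) * hr₃ - hs
  have hdisc : ((r - r₂) * (r - r₃) * (r₂ - r₃)) ^ 2 = (t + 7) * (1183 - 27 * t) := by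
    have h1 : (r - r₂) * (r - r₃) = 3 * r ^ 2 + 14 * r := by
      linear_combination hprod - 2 * r * hsum
    rw [h1, hdiff, mul_pow, hs, ← hr']
    ring
  have hne : (r - r₂) * (r - r₃) * (r₂ - r₃) ≠ 0 := fun h ↦ ht (by rw [← hdisc, h]; ring)
  refine ⟨r, r₂, r₃, ?_, ?_, ?_, fun x ↦ ?_, hdisc⟩
  · rintro rfl
    simp at hne
  · rintro rfl
    simp at hne
  · rintro rfl
    simp at hne
  · have : cubic x - t = (x - r) * ((x - r₂) * (x - r₃)) := by
      rw [cubic, ← hr']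
      linear_combination (x - r) * (x + r) * hsum - (x - r) * hprod
    rw [← sub_eq_zero, this, mul_eq_zero, mul_eq_zero, sub_eq_zero, sub_eq_zero, sub_eq_zero]

theorem discr_ne_zero_of_root {k : Type*} [Field k] [CharZero k] {m : ℕ} {t : k}
    (ht : cubic^[m] t = 0) : (t + 7) * (1183 - 27 * t) ≠ 0 := by
  refine mul_ne_zero (fun h ↦ ?_) fun h ↦ ?_
  · have h1 : cubic^[m + 1] (0 : k) = 0 := by
      rw [Function.iterate_succ_apply, show cubic (0 : k) = t by rw [cubic]; linear_combination -h,
        ht]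
    rw [cubic_iterate_zero m.succ_ne_zero] at h1
    norm_num at h1
  · have h1 := critDen_mul_cubic_iterate (c := t) (by linear_combination -h) m
    rw [ht, mul_zero, zero_eq_mul] at h1
    rcases h1 with h1 | h1
    · norm_num at h1
    · exact (critNum_pos m).ne' (by exact_mod_cast h1)

/-- The roots of the `n`-th iterate of `X³ + 7X² - 7`. -/
abbrev LevelRoot (n : ℕ) : Type := {x : AlgebraicClosure ℚ // cubic^[n] x = 0}

/-- The roots of the `n`-th iterate as the root set of the polynomial. -/
def levelRootEquiv (n : ℕ) :
    LevelRoot n ≃ (polyIter cubicPoly n).rootSet (AlgebraicClosure ℚ) :=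
  Equiv.subtypeEquivRight fun _ ↦ mem_rootSet_polyIter.symm

noncomputable instance (n : ℕ) : Fintype (LevelRoot n) := Fintype.ofEquiv _ (levelRootEquiv n).symm

theorem card_levelRoot (n : ℕ) : Fintype.card (LevelRoot n) = 3 ^ n := by
  rw [Fintype.card_congr (levelRootEquiv n), card_rootSet_polyIter]

/-- The map from the roots of an iterate to those of the previous one. -/
noncomputable def levelMap (m : ℕ) (x : LevelRoot (m + 1)) : LevelRoot m := ⟨cubic x.1, x.2⟩

theorem exists_cubic_fibre_of_levelRoot {m : ℕ} (t : LevelRoot m) :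
    ∃ r₁ r₂ r₃ : LevelRoot (m + 1), r₁ ≠ r₂ ∧ r₁ ≠ r₃ ∧ r₂ ≠ r₃ ∧
      (∀ x, levelMap m x = t ↔ x = r₁ ∨ x = r₂ ∨ x = r₃) ∧
      ((r₁.1 - r₂) * (r₁ - r₃) * (r₂ - r₃)) ^ 2 = (t.1 + 7) * (1183 - 27 * t) := by
  obtain ⟨r₁, r₂, r₃, h₁₂, h₁₃, h₂₃, hr, hd⟩ :=
    exists_cubic_fibre two_ne_zero (discr_ne_zero_of_root t.2)
  have hroot : ∀ x, cubic x = t.1 → cubic^[m + 1] x = 0 := fun x hx ↦ by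
    rw [Function.iterate_succ_apply, hx, t.2]
  refine ⟨⟨r₁, hroot _ ((hr _).mpr (.inl rfl))⟩, ⟨r₂, hroot _ ((hr _).mpr (.inr (.inl rfl)))⟩,
    ⟨r₃, hroot _ ((hr _).mpr (.inr (.inr rfl)))⟩, ?_, ?_, ?_, fun x ↦ ?_, hd⟩
  · exact fun h ↦ h₁₂ (congrArg Subtype.val h)
  · exact fun h ↦ h₁₃ (congrArg Subtype.val h)
  · exact fun h ↦ h₂₃ (congrArg Subtype.val h)
  · rw [Subtype.ext_iff, Subtype.ext_iff, Subtype.ext_iff, Subtype.ext_iff]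
    exact hr x.1

theorem card_levelMap_fibre {m : ℕ} (t : LevelRoot m) :
    Nat.card {x // levelMap m x = t} = 3 := by
  obtain ⟨r₁, r₂, r₃, h₁₂, h₁₃, h₂₃, hr, -⟩ := exists_cubic_fibre_of_levelRoot t
  rw [show {x // levelMap m x = t} = ({r₁, r₂, r₃} : Set (LevelRoot (m + 1))) from ?_,
    Nat.card_coe_set_eq, Set.ncard_eq_three]
  · exact ⟨r₁, r₂, r₃, h₁₂, h₁₃, h₂₃, rfl⟩
  · congr 1
    ext x
    exact hr x

theorem map_mem_Kfield {n : ℕ} (σ : AlgebraicClosure ℚ ≃ₐ[ℚ] AlgebraicClosure ℚ)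
    {a : AlgebraicClosure ℚ} (ha : a ∈ Kfield cubicPoly n) : σ a ∈ Kfield cubicPoly n := by
  have hle : (Kfield cubicPoly n).map (σ : AlgebraicClosure ℚ →ₐ[ℚ] AlgebraicClosure ℚ) ≤
      Kfield cubicPoly n := by
    rw [Kfield, IntermediateField.adjoin_map, IntermediateField.adjoin_le_iff]
    rintro _ ⟨x, hx, rfl⟩
    refine mem_Kfield_of_root ?_
    have := map_cubic_iterate (σ : AlgebraicClosure ℚ →+* AlgebraicClosure ℚ) n x
    rw [mem_rootSet_polyIter.mp hx, map_zero] at this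
    exact this.symm
  exact hle ⟨a, ha, rfl⟩

theorem Kfield_le_succ (m : ℕ) : Kfield cubicPoly m ≤ Kfield cubicPoly (m + 1) := by
  rw [Kfield, IntermediateField.adjoin_le_iff]
  intro t ht
  obtain ⟨r, _, _, -, -, -, hr, -⟩ :=
    exists_cubic_fibre_of_levelRoot (⟨t, mem_rootSet_polyIter.mp ht⟩ : LevelRoot m)
  have h1 : cubic r.1 = t := congrArg Subtype.val ((hr r).mpr (.inl rfl))
  rw [← h1, cubic]
  have := mem_Kfield_of_root r.2
  exact sub_mem (add_mem (pow_mem this 3) (mul_mem (ofNat_mem _ 7) (pow_mem this 2)))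
    (ofNat_mem _ 7)

theorem exists_algEquiv_apply_eq {n : ℕ} (x y : LevelRoot n) :
    ∃ σ : AlgebraicClosure ℚ ≃ₐ[ℚ] AlgebraicClosure ℚ, σ x = y := by
  have := isGalois_rat_algebraicClosure
  obtain ⟨σ, hσ⟩ := isConjRoot_iff_exists_algEquiv.mp
    (show IsConjRoot ℚ y.1 x.1 by
      rw [IsConjRoot, minpoly_eq_of_root x.2, minpoly_eq_of_root y.2])
  exact ⟨σ, hσ⟩

/-- The action of an automorphism of the algebraic closure on the roots of the `n`-th iterate. -/
noncomputable def levelPerm (n : ℕ) :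
    (AlgebraicClosure ℚ ≃ₐ[ℚ] AlgebraicClosure ℚ) →* Equiv.Perm (LevelRoot n) where
  toFun σ := (σ : AlgebraicClosure ℚ ≃ AlgebraicClosure ℚ).subtypeEquiv fun x ↦ by
    have := map_cubic_iterate (σ : AlgebraicClosure ℚ →+* AlgebraicClosure ℚ) n x
    rw [show (σ : AlgebraicClosure ℚ ≃ AlgebraicClosure ℚ) x =
      (σ : AlgebraicClosure ℚ →+* AlgebraicClosure ℚ) x from rfl, ← this]
    simp
  map_one' := rfl
  map_mul' _ _ := rfl

/-- The permutations of the roots at level `m + 1` induced by automorphisms fixing the splitting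
field at level `m`. -/
noncomputable def levelGroup (m : ℕ) : Subgroup (Equiv.Perm (LevelRoot (m + 1))) :=
  (Kfield cubicPoly m).fixingSubgroup.map (levelPerm (m + 1))

theorem levelMap_levelPerm {m : ℕ} (σ : AlgebraicClosure ℚ ≃ₐ[ℚ] AlgebraicClosure ℚ)
    (x : LevelRoot (m + 1)) :
    levelMap m (levelPerm (m + 1) σ x) = levelPerm m σ (levelMap m x) :=
  Subtype.ext (map_cubic (σ : AlgebraicClosure ℚ →+* AlgebraicClosure ℚ) x.1).symm

theorem levelMap_comp_of_mem_levelGroup {m : ℕ} {g : Equiv.Perm (LevelRoot (m + 1))}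
    (hg : g ∈ levelGroup m) : levelMap m ∘ g = levelMap m := by
  obtain ⟨σ, hσ, rfl⟩ := hg
  ext x
  rw [Function.comp_apply, levelMap_levelPerm]
  exact (mem_fixingSubgroup_iff _).mp hσ _ (mem_Kfield_of_root (levelMap m x).2)

open Classical in
theorem swap_mem_levelGroup_conj {m : ℕ} {x y : LevelRoot (m + 1)}
    (h : Equiv.swap x y ∈ levelGroup m) (τ : AlgebraicClosure ℚ ≃ₐ[ℚ] AlgebraicClosure ℚ) :
    Equiv.swap (levelPerm _ τ x) (levelPerm _ τ y) ∈ levelGroup m := by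
  rw [Equiv.swap_apply_apply]
  obtain ⟨σ, hσ, h⟩ := h
  refine ⟨τ * σ * τ⁻¹, (mem_fixingSubgroup_iff _).mpr fun a ha ↦ ?_, ?_⟩
  · have h1 := (mem_fixingSubgroup_iff _).mp hσ (τ⁻¹ a) (map_mem_Kfield _ ha)
    rw [mul_smul, mul_smul, AlgEquiv.smul_def τ⁻¹ a, h1]
    exact τ.apply_symm_apply a
  · rw [map_mul, map_mul, map_inv, h]

theorem exists_swap_mem_levelGroup {m : ℕ} (hm : m ≠ 0) :
    ∃ a b : LevelRoot (m + 1), a ≠ b ∧ levelMap m a = levelMap m b ∧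
      open Classical in Equiv.swap a b ∈ levelGroup m := by
  classical
  have := isGalois_rat_algebraicClosure
  choose r₁ r₂ r₃ h₁₂ h₁₃ h₂₃ hr hdisc using exists_cubic_fibre_of_levelRoot (m := m)
  obtain ⟨t₀, ht₀, hsq⟩ := exists_root_forall_sq_ne_prod hm
  let d : LevelRoot m → AlgebraicClosure ℚ := fun t ↦
    ((r₁ t).1 - r₂ t) * (r₁ t - r₃ t) * (r₂ t - r₃ t)
  have hfix : ∀ (σ : AlgebraicClosure ℚ ≃ₐ[Kfield cubicPoly m] AlgebraicClosure ℚ)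
      (t : LevelRoot m), σ t = t := fun σ t ↦
    σ.commutes ⟨t, mem_Kfield_of_root t.2⟩
  obtain ⟨σ, hneg, hpos⟩ := exists_algEquiv_neg_of_forall_prod_notMem
    (K := Kfield cubicPoly m) d
    (fun σ t ↦ by
      rw [← sq_eq_sq_iff_eq_or_eq_neg, ← map_pow, hdisc]
      simp only [map_mul, map_add, map_sub, map_ofNat, hfix]) ⟨t₀, ht₀⟩
    (fun S hS hmem ↦ by
      obtain ⟨y, hy⟩ := IntermediateField.mem_bot.mp hmem
      refine hsq (S.map (Function.Embedding.subtype _)) (fun t ht ↦ ?_) ?_ y y.2 ?_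
      · obtain ⟨t, -, rfl⟩ := Finset.mem_map.mp ht
        exact t.2
      · exact Finset.mem_map_of_mem _ hS
      · rw [Finset.prod_map]
        refine (congrArg (· ^ 2) hy).trans ?_
        rw [← Finset.prod_pow]
        exact Finset.prod_congr rfl fun t _ ↦ hdisc t)
  let τ : AlgebraicClosure ℚ ≃ₐ[ℚ] AlgebraicClosure ℚ := σ.restrictScalars ℚ
  let g := levelPerm (m + 1) τ
  have hτ : τ ∈ (Kfield cubicPoly m).fixingSubgroup :=
    (mem_fixingSubgroup_iff _).mpr fun a ha ↦ σ.commutes ⟨a, ha⟩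
  have hg : g ∈ levelGroup m := ⟨τ, hτ, rfl⟩
  have hgd : ∀ t, σ (d t) = ((g (r₁ t)).1 - g (r₂ t)) * (g (r₁ t) - g (r₃ t)) *
      (g (r₂ t) - g (r₃ t)) := fun t ↦ by
    simp only [d, map_mul, map_sub]
    rfl
  have hd0 : ∀ t, d t ≠ 0 := fun t h ↦
    discr_ne_zero_of_root t.2 (by rw [← hdisc t]; exact (pow_eq_zero_iff two_ne_zero).mpr h)
  have hmap := congrFun (levelMap_comp_of_mem_levelGroup hg)
  have hr₁ : ∀ t, levelMap m (r₁ t) = t := fun t ↦ (hr t _).mpr (.inl rfl)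
  have hr₂ : ∀ t, levelMap m (r₂ t) = t := fun t ↦ (hr t _).mpr (.inr (.inl rfl))
  have hr₃ : ∀ t, levelMap m (r₃ t) = t := fun t ↦ (hr t _).mpr (.inr (.inr rfl))
  have hg₁ := fun t ↦ (hr t _).mp ((hmap (r₁ t)).trans (hr₁ t))
  have hg₂ := fun t ↦ (hr t _).mp ((hmap (r₂ t)).trans (hr₂ t))
  have hg₃ := fun t ↦ (hr t _).mp ((hmap (r₃ t)).trans (hr₃ t))
  have hi₁₂ := fun t ↦ g.injective.ne (h₁₂ t)
  have hi₁₃ := fun t ↦ g.injective.ne (h₁₃ t)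
  have hi₂₃ := fun t ↦ g.injective.ne (h₂₃ t)
  have hne2 : ∀ x : AlgebraicClosure ℚ, x = -x → x = 0 := fun x hx ↦ self_eq_neg.mp hx
  have hcube : ∀ t ≠ ⟨t₀, ht₀⟩, ∀ x, levelMap m x = t → g (g (g x)) = x := by
    intro t ht x hx
    have hs := (hgd t).symm.trans (hpos t ht)
    have h0 := hd0 t
    rcases hg₁ t with h1 | h1 | h1 <;> rcases hg₂ t with h2 | h2 | h2 <;>
      rcases hg₃ t with h3 | h3 | h3 <;> simp only [h1, h2, h3, d] at hs <;>
      first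
      | exact absurd (h1.trans h2.symm) (hi₁₂ t)
      | exact absurd (h1.trans h3.symm) (hi₁₃ t)
      | exact absurd (h2.trans h3.symm) (hi₂₃ t)
      | (rcases (hr t x).mp hx with rfl | rfl | rfl <;> simp [h1, h2, h3]; done)
      | exact absurd (hne2 _ (by dsimp only [d]; linear_combination -hs)) h0
  have key : ∃ a b, a ≠ b ∧ levelMap m a = ⟨t₀, ht₀⟩ ∧ levelMap m b = ⟨t₀, ht₀⟩ ∧
      ∀ x, levelMap m x = ⟨t₀, ht₀⟩ → g (g (g x)) = Equiv.swap a b x := by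
    set t : LevelRoot m := ⟨t₀, ht₀⟩
    have hs := (hgd t).symm.trans hneg
    have h0 := hd0 t
    rcases hg₁ t with h1 | h1 | h1 <;> rcases hg₂ t with h2 | h2 | h2 <;>
      rcases hg₃ t with h3 | h3 | h3 <;> simp only [h1, h2, h3, d] at hs <;>
      first
      | exact absurd (h1.trans h2.symm) (hi₁₂ t)
      | exact absurd (h1.trans h3.symm) (hi₁₃ t)
      | exact absurd (h2.trans h3.symm) (hi₂₃ t)
      | (refine ⟨r₁ t, r₂ t, h₁₂ t, hr₁ t, hr₂ t, fun x hx ↦ ?_⟩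
         rcases (hr t x).mp hx with rfl | rfl | rfl <;> simp [h1, h2, h3,
           Equiv.swap_apply_of_ne_of_ne (h₁₃ t).symm (h₂₃ t).symm]
         done)
      | (refine ⟨r₁ t, r₃ t, h₁₃ t, hr₁ t, hr₃ t, fun x hx ↦ ?_⟩
         rcases (hr t x).mp hx with rfl | rfl | rfl <;> simp [h1, h2, h3,
           Equiv.swap_apply_of_ne_of_ne (h₁₂ t).symm (h₂₃ t)]
         done)
      | (refine ⟨r₂ t, r₃ t, h₂₃ t, hr₂ t, hr₃ t, fun x hx ↦ ?_⟩
         rcases (hr t x).mp hx with rfl | rfl | rfl <;> simp [h1, h2, h3,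
           Equiv.swap_apply_of_ne_of_ne (h₁₂ t) (h₁₃ t)]
         done)
      | exact absurd (hne2 _ (by dsimp only [d]; linear_combination hs)) h0
  obtain ⟨a, b, hab, ha, hb, hswap⟩ := key
  refine ⟨a, b, hab, ha.trans hb.symm, ?_⟩
  have : Equiv.swap a b = g ^ 3 := by
    ext1 x
    rw [pow_three, Equiv.Perm.mul_apply, Equiv.Perm.mul_apply]
    by_cases hx : levelMap m x = ⟨t₀, ht₀⟩
    · exact (hswap x hx).symm
    · rw [hcube _ hx x rfl]
      refine Equiv.swap_apply_of_ne_of_ne ?_ ?_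
      · exact fun h ↦ hx (h ▸ ha)
      · exact fun h ↦ hx (h ▸ hb)
  rw [this]
  exact pow_mem hg 3

theorem mem_levelGroup_iff {m : ℕ} (hm : m ≠ 0) {g : Equiv.Perm (LevelRoot (m + 1))} :
    g ∈ levelGroup m ↔ levelMap m ∘ g = levelMap m := by
  classical
  refine ⟨levelMap_comp_of_mem_levelGroup, fun hg ↦ ?_⟩
  let S : Set (Equiv.Perm (LevelRoot (m + 1))) := {s | s.IsSwap ∧ s ∈ levelGroup m}
  suffices h : g ∈ Subgroup.closure S from
    (Subgroup.closure_le _).mpr (fun s hs ↦ hs.2) h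
  rw [mem_closure_isSwap fun s hs ↦ hs.1]
  refine ⟨Set.toFinite _, fun y ↦ ?_⟩
  set x := g y
  have hxy : levelMap m x = levelMap m y := congrFun hg y
  let R := MulAction.orbitRel (Subgroup.closure S) (LevelRoot (m + 1))
  change R x y
  have hstep : ∀ u v, u ≠ v → Equiv.swap u v ∈ levelGroup m → R u v := fun u v huv h ↦
    ⟨⟨_, Subgroup.subset_closure ⟨⟨u, v, huv, rfl⟩, h⟩⟩, Equiv.swap_apply_right u v⟩
  obtain ⟨a, b, hab, hmap, hsw⟩ := exists_swap_mem_levelGroup hm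
  have hex : ∀ u, ∃ v, u ≠ v ∧ levelMap m u = levelMap m v ∧ R u v := fun u ↦ by
    obtain ⟨τ, hτ⟩ := exists_algEquiv_apply_eq a u
    obtain rfl : levelPerm (m + 1) τ a = u := Subtype.ext hτ
    have hne : levelPerm (m + 1) τ a ≠ levelPerm (m + 1) τ b := (levelPerm _ τ).injective.ne hab
    refine ⟨levelPerm (m + 1) τ b, hne, ?_, hstep _ _ hne (swap_mem_levelGroup_conj hsw τ)⟩
    rw [levelMap_levelPerm, levelMap_levelPerm, hmap]
  obtain ⟨r₁, r₂, r₃, h₁₂, h₁₃, h₂₃, hr, -⟩ := exists_cubic_fibre_of_levelRoot (levelMap m y)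
  obtain ⟨u, hu, hmu, hRu⟩ := hex x
  obtain ⟨v, hv, hmv, hRv⟩ := hex y
  rcases eq_or_ne x y with hne | hne
  · rw [hne]
  rcases eq_or_ne u y with rfl | huy
  · exact hRu
  rcases eq_or_ne v x with hvx | hvx
  · rw [← hvx]
    exact R.symm hRv
  have huv : u = v := by
    have hx := (hr x).mp hxy
    have hy := (hr y).mp rfl
    have hu' := (hr u).mp (hmu.symm.trans hxy)
    have hv' := (hr v).mp hmv.symm
    grind
  exact R.trans hRu (huv ▸ R.symm hRv)

theorem normal_Kfield (n : ℕ) : Normal ℚ (Kfield cubicPoly n) := by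
  have := isGalois_rat_algebraicClosure
  refine IntermediateField.normal_iff_forall_map_le'.mpr fun σ ↦ ?_
  rintro _ ⟨x, hx, rfl⟩
  exact map_mem_Kfield σ hx

theorem card_perm_levelMap_comp (m : ℕ) :
    Nat.card {g : Equiv.Perm (LevelRoot (m + 1)) // levelMap m ∘ g = levelMap m} =
      6 ^ 3 ^ m := by
  classical
  rw [Nat.card_eq_fintype_card, DomMulAct.stabilizer_card (levelMap m)]
  have : ∀ t, (Fintype.card {x // levelMap m x = t}).factorial = 6 := fun t ↦ by
    rw [← Nat.card_eq_fintype_card, card_levelMap_fibre]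
    rfl
  rw [Finset.prod_congr rfl fun t _ ↦ this t, Finset.prod_const, Finset.card_univ, card_levelRoot]

theorem relGalCard_succ (m : ℕ) : relGalCard cubicPoly (m + 1) = Nat.card (levelGroup m) := by
  have := normal_Kfield (m + 1)
  have := isGalois_rat_algebraicClosure
  let K := Kfield cubicPoly (m + 1)
  rw [relGalCard, Nat.add_sub_cancel]
  have hlift : ∀ σ : K ≃ₐ[ℚ] K, ∃ τ : AlgebraicClosure ℚ ≃ₐ[ℚ] AlgebraicClosure ℚ,
      ∀ x : K, τ x = σ x := fun σ ↦ by
    obtain ⟨τ, rfl⟩ := AlgEquiv.restrictNormalHom_surjective (F := ℚ) (K₁ := K)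
      (AlgebraicClosure ℚ) σ
    exact ⟨τ, fun x ↦ (AlgEquiv.restrictNormal_commutes τ K x).symm⟩
  choose τ hτ using hlift
  refine Nat.card_congr (Equiv.ofBijective (fun σ ↦ ⟨levelPerm (m + 1) (τ σ.1), τ σ.1,
    (mem_fixingSubgroup_iff _).mpr fun a ha ↦ ?_, rfl⟩) ⟨fun σ σ' h ↦ ?_, ?_⟩)
  · have ha' := Kfield_le_succ m ha
    exact (hτ σ.1 ⟨a, ha'⟩).trans (congrArg Subtype.val (σ.2 a ha ha'))
  · have hroot : ∀ x : LevelRoot (m + 1), σ.1 ⟨x, mem_Kfield_of_root x.2⟩ =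
        σ'.1 ⟨x, mem_Kfield_of_root x.2⟩ := fun x ↦ Subtype.ext <| by
      rw [← hτ, ← hτ]
      exact congrArg Subtype.val (DFunLike.congr_fun (congrArg Subtype.val h) x)
    have halg : σ.1.toAlgHom = σ'.1.toAlgHom := by
      refine IntermediateField.algHom_ext_of_eq_adjoin (F := ℚ) (E := AlgebraicClosure ℚ) (S := K)
        (s := (polyIter cubicPoly (m + 1)).rootSet (AlgebraicClosure ℚ)) (K := K) rfl fun x hx ↦ ?_
      exact hroot ⟨x, mem_rootSet_polyIter.mp hx⟩
    exact Subtype.ext (AlgEquiv.ext fun x ↦ DFunLike.congr_fun halg x)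
  · rintro ⟨_, ρ, hρ, rfl⟩
    have hres : ∀ x : K, ((ρ.restrictNormal K x : K) : AlgebraicClosure ℚ) = ρ x :=
      AlgEquiv.restrictNormal_commutes ρ K
    refine ⟨⟨ρ.restrictNormal K, fun a ha ha' ↦ Subtype.ext ?_⟩, ?_⟩
    · exact (hres ⟨a, ha'⟩).trans ((mem_fixingSubgroup_iff _).mp hρ a ha)
    · refine Subtype.ext (Equiv.ext fun x ↦ Subtype.ext ?_)
      exact (hτ _ ⟨x, mem_Kfield_of_root x.2⟩).trans (hres _)

theorem relGalCard_succ_of_ne_zero {m : ℕ} (hm : m ≠ 0) :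
    relGalCard cubicPoly (m + 1) = 6 ^ 3 ^ m := by
  rw [relGalCard_succ, ← card_perm_levelMap_comp]
  exact Nat.card_congr (Equiv.subtypeEquivRight fun _ ↦ mem_levelGroup_iff hm)

theorem Kfield_zero : Kfield cubicPoly 0 = ⊥ := by
  rw [Kfield, IntermediateField.adjoin_eq_bot_iff]
  intro x hx
  obtain rfl : x = 0 := mem_rootSet_polyIter.mp hx
  exact zero_mem _

theorem Kfield_one_eq_adjoin (α : LevelRoot 1) :
    Kfield cubicPoly 1 = IntermediateField.adjoin ℚ {α.1} := by
  refine le_antisymm ?_ ?_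
  · rw [Kfield, IntermediateField.adjoin_le_iff]
    intro x hx
    set F := IntermediateField.adjoin ℚ {α.1}
    have hα : α.1 ∈ F := IntermediateField.mem_adjoin_simple_self ℚ _
    have hx0 : cubic x = 0 := mem_rootSet_polyIter.mp hx
    have hα0 : cubic α.1 = 0 := α.2
    rw [cubic] at hx0 hα0
    by_cases hxα : x = α.1
    · rw [hxα]
      exact hα
    have hquad : x ^ 2 + (α.1 + 7) * x + (α.1 ^ 2 + 7 * α.1) = 0 := by
      apply mul_left_cancel₀ (sub_ne_zero.mpr hxα)
      linear_combination hx0 - hα0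
    have hdisc : ((2 * x + α.1 + 7) * (3 * α.1 ^ 2 + 14 * α.1)) ^ 2 = 91 ^ 2 := by
      linear_combination 4 * (3 * α.1 ^ 2 + 14 * α.1) ^ 2 * hquad +
        (-27 * α.1 ^ 3 - 189 * α.1 ^ 2 + 1183) * hα0
    have hne : 3 * α.1 ^ 2 + 14 * α.1 ≠ 0 := fun h ↦ by
      rw [h] at hdisc
      norm_num at hdisc
    have hmem3 : 3 * α.1 ^ 2 + 14 * α.1 ∈ F :=
      add_mem (mul_mem (ofNat_mem _ 3) (pow_mem hα 2)) (mul_mem (ofNat_mem _ 14) hα)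
    have hmem : (2 * x + α.1 + 7) * (3 * α.1 ^ 2 + 14 * α.1) ∈ F := by
      rcases sq_eq_sq_iff_eq_or_eq_neg.mp hdisc with h | h <;> rw [h]
      · exact ofNat_mem _ 91
      · exact neg_mem (ofNat_mem _ 91)
    have hx' : x = ((2 * x + α.1 + 7) * (3 * α.1 ^ 2 + 14 * α.1) / (3 * α.1 ^ 2 + 14 * α.1) -
        α.1 - 7) / 2 := by
      rw [mul_div_cancel_right₀ _ hne]
      ring
    rw [SetLike.mem_coe, hx']
    exact div_mem (sub_mem (sub_mem (div_mem hmem hmem3) hα) (ofNat_mem _ 7)) (ofNat_mem _ 2)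
  · rw [IntermediateField.adjoin_simple_le_iff]
    exact mem_Kfield_of_root α.2

theorem relGalCard_one : relGalCard cubicPoly 1 = 3 := by
  have := isGalois_rat_algebraicClosure
  have := normal_Kfield 1
  obtain ⟨α⟩ : Nonempty (LevelRoot 1) := by
    rw [← Fintype.card_pos_iff, card_levelRoot]
    norm_num
  have hrank : Module.finrank ℚ (Kfield cubicPoly 1) = 3 := by
    rw [Kfield_one_eq_adjoin α, IntermediateField.adjoin.finrank (Algebra.IsIntegral.isIntegral _),
      minpoly_eq_of_root α.2, (polyIter_monic 1).natDegree_map, polyIter_natDegree, pow_one]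
  have : FiniteDimensional ℚ (Kfield cubicPoly 1) := .of_finrank_pos (by rw [hrank]; norm_num)
  have : IsGalois ℚ (Kfield cubicPoly 1) := ⟨⟩
  rw [relGalCard, ← hrank, ← IsGalois.card_aut_eq_finrank]
  refine Nat.card_congr (Equiv.subtypeUnivEquiv fun σ x hx hx' ↦ ?_)
  rw [Nat.sub_self, Kfield_zero] at hx
  obtain ⟨q, rfl⟩ := IntermediateField.mem_bot.mp hx
  exact σ.commutes q

/-- For `φ(x) = x³ + 7x² - 7`, the group `Gal(K_1/ℚ)` has order `3`, and for
every `n ≥ 2` the extension `K_n/K_{n-1}` is maximal, i.e. `Gal(K_n/K_{n-1})` has order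
`6^(3^(n-1))`. (So the arboreal image of `φ` is an index-2 subgroup of `Aut(T_∞)`.) -/
theorem stmt_5 (φ : Polynomial ℤ) (hφ : φ = X ^ 3 + C 7 * X ^ 2 - C 7) :
    relGalCard φ 1 = 3 ∧
      ∀ n : ℕ, 2 ≤ n → relGalCard φ n = 6 ^ (3 ^ (n - 1)) := by
  obtain rfl : φ = cubicPoly := hφ
  refine ⟨relGalCard_one, fun n hn ↦ ?_⟩
  obtain ⟨m, rfl⟩ := Nat.exists_eq_add_of_le' (Nat.one_le_of_lt hn)
  exact relGalCard_succ_of_ne_zero (by lia)
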